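/- arXiv:2406.16971 — 6 statements merged into one kernel-verified Lean document; each statement's English description precedes it below -/
import Mathlib

section
/- Let λ > 0, μ ∈ ℝ, σ > 0, let Z be a real random variable with density p satisfying p(z)/p_N(z; μ, σ²) → 1 as z → +∞, and let X = h(g(Z)) have density q satisfying the change-of-variables identity q(h(g(z)))·g'(z)·h'(g(z)) = p(z) for all z ∈ ℝ. Then q(x) ∼ A·x^(−1)·(λx)^B·exp(−C·(log(λx))²) as x → ∞, where A = (1/(λσ√(2π)))·exp(−μ²/(2σ²)), B = μ/(λσ²), and C = 1/(2λ²σ²). -/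
open MeasureTheory Real Filter

/-- The logistic function `g(z) = 1/(1 + exp(-z))`. -/
noncomputable def logisticFn (z : ℝ) : ℝ := 1 / (1 + Real.exp (-z))

/-- Derivative of the logistic function: `g'(z) = exp(-z)/(1 + exp(-z))²`. -/
noncomputable def logisticFnDeriv (z : ℝ) : ℝ := Real.exp (-z) / (1 + Real.exp (-z)) ^ 2

/-- The GPD quantile function `h(v) = (1/λ)((1-v)^(-λ) - 1)`. -/
noncomputable def gpdQuantile (lam v : ℝ) : ℝ := (1 / lam) * ((1 - v) ^ (-lam) - 1)

/-- Derivative of the GPD quantile function: `h'(v) = (1-v)^(-λ-1)`. -/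
noncomputable def gpdQuantileDeriv (lam v : ℝ) : ℝ := (1 - v) ^ (-lam - 1)

/-- The density of the normal distribution `N(μ, σ²)`. -/
noncomputable def normalPDF (m σ z : ℝ) : ℝ :=
  (1 / (σ * Real.sqrt (2 * Real.pi))) * Real.exp (-(z - m) ^ 2 / (2 * σ ^ 2))

lemma aux_one_sub (z : ℝ) : 1 - logisticFn z = Real.exp (-Real.log (1 + Real.exp z)) := by
  have h : 0 < 1 + Real.exp z := by positivity
  have h2 : 0 < Real.exp z := Real.exp_pos z
  rw [Real.exp_neg, Real.exp_log h, logisticFn, Real.exp_neg]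
  field_simp
  ring

lemma aux_gpd (lam z : ℝ) : gpdQuantile lam (logisticFn z)
    = (1 / lam) * (Real.exp (lam * Real.log (1 + Real.exp z)) - 1) := by
  rw [gpdQuantile, aux_one_sub, ← Real.exp_mul]
  ring_nf

lemma aux_gpdD (lam z : ℝ) : gpdQuantileDeriv lam (logisticFn z)
    = Real.exp ((lam + 1) * Real.log (1 + Real.exp z)) := by
  rw [gpdQuantileDeriv, aux_one_sub, ← Real.exp_mul]
  ring_nf

lemma aux_logD (z : ℝ) : logisticFnDeriv z
    = Real.exp (z - 2 * Real.log (1 + Real.exp z)) := by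
  have h : 0 < 1 + Real.exp z := by positivity
  have h2 : 0 < Real.exp z := Real.exp_pos z
  rw [Real.exp_sub, two_mul, Real.exp_add, Real.exp_log h, logisticFnDeriv, Real.exp_neg]
  field_simp
  ring

lemma aux_E (z : ℝ) : 0 ≤ Real.log (1 + Real.exp z) - z ∧
    Real.log (1 + Real.exp z) - z ≤ Real.exp (-z) := by
  have h2 : 0 < Real.exp z := Real.exp_pos z
  have h3 : 0 < Real.exp (-z) := Real.exp_pos _
  have e : Real.log (1 + Real.exp z) - z = Real.log (1 + Real.exp (-z)) := by
    have : 1 + Real.exp z = Real.exp z * (1 + Real.exp (-z)) := by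
      rw [mul_add, ← Real.exp_add]; simp [add_comm]
    rw [this, Real.log_mul (by positivity) (by positivity), Real.log_exp]; ring
  rw [e]
  refine ⟨Real.log_nonneg (by linarith), ?_⟩
  have := Real.log_le_sub_one_of_pos (show 0 < 1 + Real.exp (-z) by positivity)
  linarith

lemma aux_M_pos (z : ℝ) : 0 < Real.log (1 + Real.exp z) :=
  Real.log_pos (by linarith [Real.exp_pos z])

lemma aux_expM_pos (lam z : ℝ) (hlam : 0 < lam) :
    0 < Real.exp (lam * Real.log (1 + Real.exp z)) - 1 := by
  have := aux_M_pos z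
  have : 1 < Real.exp (lam * Real.log (1 + Real.exp z)) := Real.one_lt_exp_iff.2 (by positivity)
  linarith

/-- `D(z) = log(lam x) - lam z`. -/
noncomputable def auxD (lam z : ℝ) : ℝ :=
  Real.log (Real.exp (lam * Real.log (1 + Real.exp z)) - 1) - lam * z

lemma aux_D_bound (lam z : ℝ) (hlam : 0 < lam) (hs : Real.exp (-(lam * z)) ≤ 1 / 2) :
    |auxD lam z| ≤ lam * Real.exp (-z) + 2 * Real.exp (-(lam * z)) := by
  obtain ⟨hE0, hE1⟩ := aux_E z
  have hpos := aux_expM_pos lam z hlam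
  unfold auxD
  set M := Real.log (1 + Real.exp z) with hM
  set s := Real.exp (-(lam * M)) with hsdef
  have hs0 : 0 < s := Real.exp_pos _
  have hsle : s ≤ Real.exp (-(lam * z)) := by
    apply Real.exp_le_exp.2
    nlinarith
  have h1s : 0 < 1 - s := by linarith
  have e : Real.exp (lam * M) - 1 = Real.exp (lam * M) * (1 - s) := by
    rw [mul_sub, hsdef, ← Real.exp_add]; simp
  rw [e, Real.log_mul (by positivity) h1s.ne', Real.log_exp]
  have hu : Real.log (1 - s) ≤ 0 := Real.log_nonpos h1s.le (by linarith)
  have hl : -(2 * s) ≤ Real.log (1 - s) := by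
    have h := Real.one_sub_inv_le_log_of_pos h1s
    have : (1 - s)⁻¹ ≤ 1 + 2 * s := by
      rw [inv_le_iff_one_le_mul₀ h1s]
      nlinarith
    linarith
  have hm0 : 0 ≤ lam * (M - z) := by positivity
  have hm1 : lam * (M - z) ≤ lam * Real.exp (-z) := by gcongr
  have := Real.exp_pos (-z)
  have := Real.exp_pos (-(lam * z))
  rw [abs_le]
  constructor <;> nlinarith

lemma aux_z_exp (c : ℝ) (hc : 0 < c) :
    Tendsto (fun z : ℝ => z * Real.exp (-(c * z))) atTop (nhds 0) := by
  have := tendsto_rpow_mul_exp_neg_mul_atTop_nhds_zero 1 c hc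
  simpa using this

lemma aux_exp (c : ℝ) (hc : 0 < c) :
    Tendsto (fun z : ℝ => Real.exp (-(c * z))) atTop (nhds 0) :=
  Real.tendsto_exp_neg_atTop_nhds_zero.comp (tendsto_id.const_mul_atTop hc)

lemma aux_zD (lam : ℝ) (hlam : 0 < lam) :
    Tendsto (fun z => z * auxD lam z) atTop (nhds 0) := by
  have hb : Tendsto (fun z : ℝ => lam * (z * Real.exp (-(1 * z)))
      + 2 * (z * Real.exp (-(lam * z)))) atTop (nhds 0) := by
    simpa using ((aux_z_exp 1 one_pos).const_mul lam).add ((aux_z_exp lam hlam).const_mul 2)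
  refine squeeze_zero_norm' ?_ hb
  filter_upwards [(aux_exp lam hlam).eventually_le_const (show (0:ℝ) < 1/2 by norm_num),
    eventually_ge_atTop 0] with z hz hz0
  have := aux_D_bound lam z hlam hz
  rw [Real.norm_eq_abs, abs_mul, abs_of_nonneg hz0, one_mul]
  calc z * |auxD lam z| ≤ z * (lam * Real.exp (-z) + 2 * Real.exp (-(lam * z))) := by gcongr
    _ = _ := by ring

lemma aux_D (lam : ℝ) (hlam : 0 < lam) :
    Tendsto (fun z => auxD lam z) atTop (nhds 0) := by
  have hb : Tendsto (fun z : ℝ => lam * Real.exp (-(1 * z))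
      + 2 * Real.exp (-(lam * z))) atTop (nhds 0) := by
    simpa using ((aux_exp 1 one_pos).const_mul lam).add ((aux_exp lam hlam).const_mul 2)
  refine squeeze_zero_norm' ?_ hb
  filter_upwards [(aux_exp lam hlam).eventually_le_const (show (0:ℝ) < 1/2 by norm_num)] with z hz
  simpa using aux_D_bound lam z hlam hz

lemma aux_E_lim : Tendsto (fun z => Real.log (1 + Real.exp z) - z) atTop (nhds 0) :=
  squeeze_zero (fun z => (aux_E z).1) (fun z => (aux_E z).2) Real.tendsto_exp_neg_atTop_nhds_zero

/-- inverse of the transformation -/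
noncomputable def auxInv (lam x : ℝ) : ℝ := Real.log ((1 + lam * x) ^ (1 / lam) - 1)

lemma auxInv_lim (lam : ℝ) (hlam : 0 < lam) : Tendsto (auxInv lam) atTop atTop := by
  refine Real.tendsto_log_atTop.comp ?_
  refine tendsto_atTop_add_const_right _ (-1) ?_
  refine (tendsto_rpow_atTop (show 0 < 1 / lam by positivity)).comp ?_
  exact tendsto_atTop_add_const_left _ 1 (tendsto_id.const_mul_atTop hlam)

lemma auxInv_spec (lam x : ℝ) (hlam : 0 < lam) (hx : 0 < x) :
    gpdQuantile lam (logisticFn (auxInv lam x)) = x := by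
  have h1 : 1 < 1 + lam * x := by nlinarith [mul_pos hlam hx]
  have h0 : 0 < 1 + lam * x := by linarith
  have h2 : 1 < (1 + lam * x) ^ (1 / lam) := Real.one_lt_rpow h1 (by positivity)
  rw [aux_gpd, auxInv, Real.exp_log (by linarith), add_sub_cancel, Real.log_rpow h0,
    ← mul_assoc, mul_one_div_cancel hlam.ne', one_mul, Real.exp_log h0]
  field_simp
  ring

lemma aux_main (lam m σ : ℝ) (hlam : 0 < lam) (hσ : 0 < σ) (p q : ℝ → ℝ) (z : ℝ)
    (hq : 
      q (gpdQuantile lam (logisticFn z)) * logisticFnDeriv z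
        * gpdQuantileDeriv lam (logisticFn z) = p z) :
    (fun x =>
        q x /
          ((1 / (lam * σ * Real.sqrt (2 * Real.pi))) * Real.exp (-m ^ 2 / (2 * σ ^ 2))
            * x⁻¹ * (lam * x) ^ (m / (lam * σ ^ 2))
            * Real.exp (-(1 / (2 * lam ^ 2 * σ ^ 2)) * (Real.log (lam * x)) ^ 2)))
      (gpdQuantile lam (logisticFn z)) =
    p z / normalPDF m σ z * Real.exp (auxD lam z - (lam - 1) * (Real.log (1 + Real.exp z) - z)
      + (z * auxD lam z - m * auxD lam z) / (lam * σ ^ 2)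
      + auxD lam z ^ 2 / (2 * lam ^ 2 * σ ^ 2)) := by
  have hpos := aux_expM_pos lam z hlam
  set x := gpdQuantile lam (logisticFn z) with hx
  set D := auxD lam z with hD
  set M := Real.log (1 + Real.exp z) with hM
  have hlx : lam * x = Real.exp (lam * M) - 1 := by
    rw [hx, aux_gpd, ← hM]; field_simp
  have hL : Real.log (lam * x) = lam * z + D := by
    rw [hlx, hD, auxD]; ring
  have hlx' : lam * x = Real.exp (lam * z + D) := by
    rw [← hL, Real.exp_log]; rw [hlx]; exact hpos
  have hx' : x⁻¹ = lam * Real.exp (-(lam * z + D)) := by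
    rw [Real.exp_neg, ← hlx']
    have : x ≠ 0 := by
      intro h; rw [h, mul_zero] at hlx'; exact (Real.exp_pos _).ne hlx'
    field_simp
  rw [aux_gpdD, aux_logD, mul_assoc, ← Real.exp_add, ← hM] at hq
  have hs : 0 < Real.sqrt (2 * Real.pi) := by positivity
  beta_reduce
  rw [← hq, normalPDF, hL, hx', hlx', ← Real.exp_mul]
  set S := Real.sqrt (2 * Real.pi)
  have e1 : 1 / (lam * σ * S) * Real.exp (-m ^ 2 / (2 * σ ^ 2))
            * (lam * Real.exp (-(lam * z + D))) * Real.exp ((lam * z + D) * (m / (lam * σ ^ 2)))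
            * Real.exp (-(1 / (2 * lam ^ 2 * σ ^ 2)) * (lam * z + D) ^ 2)
      = (1 / (σ * S)) * Real.exp (-m ^ 2 / (2 * σ ^ 2) + -(lam * z + D) + (lam * z + D) * (m / (lam * σ ^ 2)) + -(1 / (2 * lam ^ 2 * σ ^ 2)) * (lam * z + D) ^ 2) := by
    simp only [Real.exp_add]
    field_simp
  have e2 : ∀ a b d k Q c : ℝ, 0 < c → a = b + d + k →
      Q / (c * Real.exp k) = Q * Real.exp b / (c * Real.exp a) * Real.exp d := by
    intro a b d k Q c hc h
    rw [h, Real.exp_add, Real.exp_add]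
    field_simp
  rw [e1]
  apply e2 _ _ _ _ _ _ (by positivity)
  field_simp
  ring

/-- if `p(z) ∼ p_N(z; μ, σ²)` as `z → ∞` and `X = h(g(Z))` has density `q`
related to `p` by the change-of-variables identity, then
`q(x) ∼ A x⁻¹ (λx)^B exp(-C (log(λx))²)` as `x → ∞`, where
`A = exp(-μ²/(2σ²))/(λσ√(2π))`, `B = μ/(λσ²)` and `C = 1/(2λ²σ²)`. -/
theorem comet_density_asymptotics
    {Ω : Type*} [MeasurableSpace Ω] (P : Measure Ω) [IsProbabilityMeasure P]
    (lam m σ : ℝ) (hlam : 0 < lam) (hσ : 0 < σ)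
    (Z : Ω → ℝ) (hZ : Measurable Z) (p q : ℝ → ℝ)
    (hp : Measure.map Z P = volume.withDensity (fun z => ENNReal.ofReal (p z)))
    (hptail : Tendsto (fun z => p z / normalPDF m σ z) atTop (nhds 1))
    (hq : ∀ z : ℝ,
      q (gpdQuantile lam (logisticFn z)) * logisticFnDeriv z
        * gpdQuantileDeriv lam (logisticFn z) = p z) :
    Tendsto
      (fun x =>
        q x /
          ((1 / (lam * σ * Real.sqrt (2 * Real.pi))) * Real.exp (-m ^ 2 / (2 * σ ^ 2))
            * x⁻¹ * (lam * x) ^ (m / (lam * σ ^ 2))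
            * Real.exp (-(1 / (2 * lam ^ 2 * σ ^ 2)) * (Real.log (lam * x)) ^ 2)))
      atTop (nhds 1) := by
  have hlim : Tendsto (fun z => p z / normalPDF m σ z *
      Real.exp (auxD lam z - (lam - 1) * (Real.log (1 + Real.exp z) - z)
      + (z * auxD lam z - m * auxD lam z) / (lam * σ ^ 2)
      + auxD lam z ^ 2 / (2 * lam ^ 2 * σ ^ 2))) atTop (nhds 1) := by
    have hD := aux_D lam hlam
    have h := ((hD.sub (aux_E_lim.const_mul (lam - 1))).add
      (((aux_zD lam hlam).sub (hD.const_mul m)).div_const (lam * σ ^ 2))).add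
      ((hD.pow 2).div_const (2 * lam ^ 2 * σ ^ 2))
    have h2 := hptail.mul ((Real.continuous_exp.tendsto _).comp h)
    simpa using h2
  refine (hlim.comp (auxInv_lim lam hlam)).congr' ?_
  filter_upwards [eventually_gt_atTop 0] with x hx
  have h := aux_main lam m σ hlam hσ p q (auxInv lam x) (hq _)
  rw [auxInv_spec lam x hlam hx] at h
  exact h.symm
end

section
/- Let λ > 0, σ > 0, let Z be a real random variable with density p satisfying p(z)/p_N(z; 0, σ²) → 1 as z → +∞, and let X = h(g(Z)) have density q satisfying the change-of-variables identity q(h(g(z)))·g'(z)·h'(g(z)) = p(z) for all z ∈ ℝ. Then q(x) ∼ (1/(λσ√(2π)·x))·exp(−(log(λx))²/(2λ²σ²)) as x → ∞; that is, q is asymptotically equivalent to the log-normal density with location parameter −log λ and scale parameter λ²σ². -/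
open MeasureTheory Real Filter

lemma aux_exp_zero (c : ℝ) (hc : 0 < c) :
    Tendsto (fun t : ℝ => Real.exp (-(c * t))) atTop (nhds 0) :=
  Real.tendsto_exp_neg_atTop_nhds_zero.comp (tendsto_id.const_mul_atTop hc)

lemma aux_sub_one (c : ℝ) (hc : 0 < c) :
    Tendsto (fun t : ℝ => 1 - Real.exp (-(c * t))) atTop (nhds 1) := by
  simpa using (aux_exp_zero c hc).const_sub 1

lemma aux_log_zero (c : ℝ) (hc : 0 < c) :
    Tendsto (fun t : ℝ => Real.log (1 - Real.exp (-(c * t)))) atTop (nhds 0) := by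
  simpa using (aux_sub_one c hc).log one_ne_zero

lemma aux_pos (c t : ℝ) (hc : 0 < c) (ht : 0 < t) : 0 < 1 - Real.exp (-(c * t)) := by
  have : Real.exp (-(c * t)) < 1 := by
    rw [Real.exp_lt_one_iff]
    have := mul_pos hc ht
    linarith
  linarith

lemma aux_mul_exp (c : ℝ) (hc : 0 < c) :
    Tendsto (fun t : ℝ => t * Real.exp (-(c * t))) atTop (nhds 0) := by
  have h := (Real.tendsto_pow_mul_exp_neg_atTop_nhds_zero 1).comp
    (tendsto_id.const_mul_atTop hc : Tendsto (fun t : ℝ => c * id t) atTop atTop)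
  have h2 := h.const_mul (1 / c)
  rw [mul_zero] at h2
  refine h2.congr fun t => ?_
  simp only [Function.comp, id, pow_one]
  field_simp

lemma aux_mul_log (c : ℝ) (hc : 0 < c) :
    Tendsto (fun t : ℝ => t * Real.log (1 - Real.exp (-(c * t)))) atTop (nhds 0) := by
  have h1 : Tendsto (fun t : ℝ => -(t * Real.exp (-(c * t)) / (1 - Real.exp (-(c * t)))))
      atTop (nhds 0) := by
    simpa using ((aux_mul_exp c hc).div (aux_sub_one c hc) one_ne_zero).neg
  refine tendsto_of_tendsto_of_tendsto_of_le_of_le' h1 tendsto_const_nhds ?_ ?_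
  · filter_upwards [eventually_gt_atTop 0] with t ht
    have hp := aux_pos c t hc ht
    have h := Real.one_sub_inv_le_log_of_pos hp
    have h2 := mul_le_mul_of_nonneg_left h ht.le
    refine le_trans (le_of_eq ?_) h2
    have hne := hp.ne'
    generalize Real.exp (-(c * t)) = u at *
    field_simp
    ring
  · filter_upwards [eventually_gt_atTop 0] with t ht
    have hp := aux_pos c t hc ht
    refine mul_nonpos_of_nonneg_of_nonpos ht.le (Real.log_nonpos hp.le ?_)
    have := Real.exp_pos (-(c * t))
    linarith

/-- if `p(z) ∼ p_N(z; 0, σ²)` as `z → ∞` and `X = h(g(Z))` has density `q`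
related to `p` by the change-of-variables identity, then
`q(x) ∼ (1/(λσ√(2π) x)) exp(-(log(λx))²/(2λ²σ²))` as `x → ∞`, i.e. `q` is asymptotically
equivalent to the log-normal density with location `-log λ` and scale `λ²σ²`. -/
theorem comet_density_lognormal_tail
    {Ω : Type*} [MeasurableSpace Ω] (P : Measure Ω) [IsProbabilityMeasure P]
    (lam σ : ℝ) (hlam : 0 < lam) (hσ : 0 < σ)
    (Z : Ω → ℝ) (hZ : Measurable Z) (p q : ℝ → ℝ)
    (hp : Measure.map Z P = volume.withDensity (fun z => ENNReal.ofReal (p z)))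
    (hptail : Tendsto (fun z => p z / normalPDF 0 σ z) atTop (nhds 1))
    (hq : ∀ z : ℝ,
      q (gpdQuantile lam (logisticFn z)) * logisticFnDeriv z
        * gpdQuantileDeriv lam (logisticFn z) = p z) :
    Tendsto
      (fun x =>
        q x /
          ((1 / (lam * σ * Real.sqrt (2 * Real.pi) * x))
            * Real.exp (-(Real.log (lam * x)) ^ 2 / (2 * lam ^ 2 * σ ^ 2))))
      atTop (nhds 1) := by
  set w : ℝ → ℝ := fun t => t + (1 / lam) * Real.log (1 - Real.exp (-(lam * t))) with hw
  set z : ℝ → ℝ := fun t => t + Real.log (1 - Real.exp (-(1 * t))) with hz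
  have hztop : Tendsto z atTop atTop :=
    tendsto_id.atTop_add (aux_log_zero 1 one_pos)
  have hwz : Tendsto (fun t => (w t ^ 2 - z t ^ 2) / (2 * σ ^ 2)) atTop (nhds 0) := by
    have h := ((((aux_mul_log lam hlam).const_mul (2 / lam)).sub
      ((aux_mul_log 1 one_pos).const_mul 2)).add
      ((((aux_log_zero lam hlam).const_mul (1 / lam)).pow 2).sub
        ((aux_log_zero 1 one_pos).pow 2))).div_const (2 * σ ^ 2)
    have e : ((2 / lam * 0 - 2 * 0 + ((1 / lam * 0) ^ 2 - 0 ^ 2)) / (2 * σ ^ 2) : ℝ) = 0 := by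
      simp
    rw [e] at h
    refine h.congr fun t => ?_
    simp only [hw, hz]
    ring
  have hexp := (Real.continuous_exp.tendsto 0).comp hwz
  rw [Real.exp_zero] at hexp
  have hmain := (((hptail.comp hztop).mul (aux_sub_one lam hlam)).mul
    ((aux_sub_one 1 one_pos).inv₀ one_ne_zero)).mul hexp
  have hL : Tendsto (fun x : ℝ => Real.log (1 + lam * x) / lam) atTop atTop :=
    (Real.tendsto_log_atTop.comp (tendsto_atTop_add_const_left _ 1
      (tendsto_id.const_mul_atTop hlam))).atTop_div_const hlam
  have hfin := hmain.comp hL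
  simp only [mul_one, inv_one] at hfin
  refine hfin.congr' ?_
  filter_upwards [eventually_gt_atTop 0] with x hx
  have hlx : 0 < lam * x := mul_pos hlam hx
  simp only [Function.comp]
  set t := Real.log (1 + lam * x) / lam with ht
  have htpos : 0 < t := div_pos (Real.log_pos (by linarith)) hlam
  have hlt : lam * t = Real.log (1 + lam * x) := by rw [ht]; field_simp
  have helt : Real.exp (lam * t) = 1 + lam * x := by
    rw [hlt, Real.exp_log (by linarith)]
  have hA := aux_pos 1 t one_pos htpos
  have hB := aux_pos lam t hlam htpos
  have hEt := Real.exp_pos t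
  have hez : Real.exp (z t) = Real.exp t - 1 := by
    simp only [hz]
    rw [Real.exp_add, Real.exp_log hA, one_mul, mul_sub, ← Real.exp_add]
    simp
  have hE1 : 0 < Real.exp t - 1 := by rw [← hez]; exact Real.exp_pos _
  have hwx : w t = Real.log (lam * x) / lam := by
    have h1 : lam * x = Real.exp (lam * t) * (1 - Real.exp (-(lam * t))) := by
      rw [mul_sub, ← Real.exp_add, helt]; simp
    rw [h1, Real.log_mul (Real.exp_pos _).ne' hB.ne', Real.log_exp]
    simp only [hw]
    field_simp
  have hg : 1 - logisticFn (z t) = Real.exp (-t) := by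
    unfold logisticFn
    rw [Real.exp_neg, hez, Real.exp_neg]
    have : 1 + (Real.exp t - 1)⁻¹ ≠ 0 := by positivity
    field_simp
    ring
  have hxz : gpdQuantile lam (logisticFn (z t)) = x := by
    unfold gpdQuantile
    rw [hg, ← Real.exp_mul, show -t * -lam = lam * t by ring, helt]
    field_simp
    ring
  have hgd : logisticFnDeriv (z t) = (1 - Real.exp (-(1 * t))) * Real.exp (-t) := by
    unfold logisticFnDeriv
    rw [Real.exp_neg, hez, one_mul, Real.exp_neg]
    have : 1 + (Real.exp t - 1)⁻¹ ≠ 0 := by positivity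
    field_simp
    ring
  have hhd : gpdQuantileDeriv lam (logisticFn (z t)) = (1 + lam * x) * Real.exp t := by
    unfold gpdQuantileDeriv
    rw [hg, ← Real.exp_mul, show -t * (-lam - 1) = lam * t + t by ring, Real.exp_add, helt]
  have hpz := hq (z t)
  rw [hxz, hgd, hhd] at hpz
  have hpz' : p (z t) = q x * (1 - Real.exp (-(1 * t))) * (1 + lam * x) := by
    rw [← hpz, Real.exp_neg t]
    field_simp
  have hB' : 1 - Real.exp (-(lam * t)) = lam * x / (1 + lam * x) := by
    rw [Real.exp_neg, helt]
    field_simp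
    ring
  have hex : Real.exp ((w t ^ 2 - z t ^ 2) / (2 * σ ^ 2)) =
      Real.exp (-(z t - 0) ^ 2 / (2 * σ ^ 2)) /
        Real.exp (-(Real.log (lam * x)) ^ 2 / (2 * lam ^ 2 * σ ^ 2)) := by
    rw [← Real.exp_sub, hwx]
    congr 1
    field_simp
    ring
  have hpi : 0 < Real.sqrt (2 * Real.pi) := by positivity
  rw [hex, hB', hpz']
  unfold normalPDF
  have e1 := Real.exp_pos (-(z t - 0) ^ 2 / (2 * σ ^ 2))
  have e2 := Real.exp_pos (-(Real.log (lam * x)) ^ 2 / (2 * lam ^ 2 * σ ^ 2))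
  generalize Real.exp (-(z t - 0) ^ 2 / (2 * σ ^ 2)) = a at *
  generalize Real.exp (-(Real.log (lam * x)) ^ 2 / (2 * lam ^ 2 * σ ^ 2)) = b at *
  generalize 1 - Real.exp (-(1 * t)) = d at *
  generalize Real.sqrt (2 * Real.pi) = r at *
  have h1 : 1 + lam * x ≠ 0 := by positivity
  field_simp
end

section
/- Let λ > 0, μ ∈ ℝ, σ > 0, let Z be a real random variable with density p satisfying p(z)/p_N(z; μ, σ²) → 1 as z → +∞, and let X = S(Z; λ) have density q satisfying the change-of-variables identity q(S(z; λ))·S'(z; λ) = p(z) for all z ∈ ℝ. Then q is regularly varying of index −(1 + 1/(λσ²)); that is, X lies in the Fréchet domain of attraction with shape parameter λσ². -/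
open MeasureTheory Real Filter

/-- The complementary error function `erfc(z) = (2/√π) ∫_z^∞ exp(-t²) dt`. -/
noncomputable def erfc (z : ℝ) : ℝ :=
  (2 / Real.sqrt Real.pi) * ∫ t in Set.Ioi z, Real.exp (-t ^ 2)

/-- The simplified TTF transformation `S(z; λ) = (1/λ)(erfc(z/√2)^(-λ) - 1)`. -/
noncomputable def ttf (lam z : ℝ) : ℝ :=
  (1 / lam) * ((erfc (z / Real.sqrt 2)) ^ (-lam) - 1)

/-- Derivative of the simplified TTF transformation:
`S'(z; λ) = √(2/π) exp(-z²/2) erfc(z/√2)^(-λ-1)`. -/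
noncomputable def ttfDeriv (lam z : ℝ) : ℝ :=
  Real.sqrt (2 / Real.pi) * Real.exp (-z ^ 2 / 2) * (erfc (z / Real.sqrt 2)) ^ (-lam - 1)

lemma aux_int : Integrable (fun t : ℝ => Real.exp (-t ^ 2)) := by
  simpa using integrable_exp_neg_mul_sq (b := 1) one_pos

lemma aux_split (z : ℝ) : ∫ t in Set.Ioi z, Real.exp (-t ^ 2)
    = (∫ t in Set.Ioi (0:ℝ), Real.exp (-t ^ 2)) - ∫ t in (0:ℝ)..z, Real.exp (-t ^ 2) := by
  have := intervalIntegral.integral_Ioi_sub_Ioi' (a := 0) (b := z) (μ := volume)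
    (f := fun t : ℝ => Real.exp (-t ^ 2)) aux_int.integrableOn aux_int.integrableOn
  linarith

lemma aux_deriv (z : ℝ) :
    HasDerivAt (fun z : ℝ => ∫ t in Set.Ioi z, Real.exp (-t ^ 2)) (-Real.exp (-z ^ 2)) z := by
  have h0 : (fun z : ℝ => ∫ t in Set.Ioi z, Real.exp (-t ^ 2)) = fun z =>
    (∫ t in Set.Ioi (0:ℝ), Real.exp (-t ^ 2)) - ∫ t in (0:ℝ)..z, Real.exp (-t ^ 2) := by
    funext z; exact aux_split z
  rw [h0]
  have hc : Continuous (fun t : ℝ => Real.exp (-t ^ 2)) := by fun_prop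
  exact (hc.integral_hasStrictDerivAt 0 z).hasDerivAt.const_sub _

lemma aux_pos_s8 (z : ℝ) : 0 < ∫ t in Set.Ioi z, Real.exp (-t ^ 2) := by
  rw [setIntegral_pos_iff_support_of_nonneg_ae]
  · have : Function.support (fun t : ℝ => Real.exp (-t ^ 2)) = Set.univ := by
      ext t; simp [Real.exp_ne_zero]
    rw [this]; simp
  · exact Eventually.of_forall fun t => (Real.exp_pos _).le
  · exact aux_int.integrableOn

lemma aux_zero : Tendsto (fun z : ℝ => ∫ t in Set.Ioi z, Real.exp (-t ^ 2)) atTop (nhds 0) := by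
  have h := intervalIntegral_tendsto_integral_Ioi (μ := volume)
    (f := fun t : ℝ => Real.exp (-t ^ 2)) 0 aux_int.integrableOn tendsto_id
  have h2 := h.const_sub (∫ t in Set.Ioi (0:ℝ), Real.exp (-t ^ 2))
  rw [sub_self] at h2
  refine h2.congr fun z => ?_
  rw [aux_split z]; rfl

lemma aux_mills : Tendsto (fun z : ℝ => (∫ t in Set.Ioi z, Real.exp (-t ^ 2)) /
    (Real.exp (-z ^ 2) * z⁻¹)) atTop (nhds (1 / 2)) := by
  have hg : ∀ z : ℝ, 0 < z → HasDerivAt (fun z : ℝ => Real.exp (-z ^ 2) * z⁻¹)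
      (-Real.exp (-z ^ 2) * (2 + (z ^ 2)⁻¹)) z := by
    intro z hz
    have h1 : HasDerivAt (fun z : ℝ => -z ^ 2) (-(2 * z)) z := by
      have h0 := (hasDerivAt_pow 2 z).fun_neg
      exact h0.congr_deriv (by simp)
    refine (h1.exp.mul (hasDerivAt_inv hz.ne')).congr_deriv ?_
    field_simp
    ring
  refine HasDerivAt.lhopital_zero_atTop (f' := fun z => -Real.exp (-z ^ 2))
    (g' := fun z => -Real.exp (-z ^ 2) * (2 + (z ^ 2)⁻¹))
    (Eventually.of_forall aux_deriv) ?_ ?_ aux_zero ?_ ?_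
  · filter_upwards [eventually_gt_atTop 0] with z hz using hg z hz
  · filter_upwards [eventually_gt_atTop 0] with z hz
    have : 0 < Real.exp (-z ^ 2) * (2 + (z ^ 2)⁻¹) := by positivity
    linarith
  · have h1 : Tendsto (fun z : ℝ => Real.exp (-z ^ 2)) atTop (nhds 0) :=
      Real.tendsto_exp_atBot.comp
        (tendsto_neg_atTop_atBot.comp (tendsto_pow_atTop two_ne_zero))
    simpa using h1.mul tendsto_inv_atTop_zero
  · have h1 : Tendsto (fun z : ℝ => 1 / (2 + (z ^ 2)⁻¹)) atTop (nhds (1 / (2 + 0))) := by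
      refine Tendsto.div tendsto_const_nhds (tendsto_const_nhds.add ?_) (by norm_num)
      exact tendsto_inv_atTop_zero.comp (tendsto_pow_atTop two_ne_zero)
    rw [add_zero] at h1
    refine h1.congr fun z => ?_
    have := Real.exp_pos (-z ^ 2)
    rw [div_mul_eq_div_div, div_self (by linarith)]

lemma erfc_pos' (z : ℝ) : 0 < erfc z := by
  have := aux_pos_s8 z
  have := Real.pi_pos
  unfold erfc; positivity

lemma erfc_cont : Continuous erfc := by
  unfold erfc
  exact continuous_const.mul
    (continuous_iff_continuousAt.2 fun z => (aux_deriv z).continuousAt)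

lemma erfc_anti : StrictAnti erfc := by
  apply strictAnti_of_deriv_neg
  intro z
  have : HasDerivAt erfc (2 / Real.sqrt Real.pi * (-Real.exp (-z ^ 2))) z :=
    (aux_deriv z).const_mul _
  rw [this.deriv]
  have h1 := Real.exp_pos (-z ^ 2)
  have h2 : 0 < 2 / Real.sqrt Real.pi := by have := Real.pi_pos; positivity
  nlinarith

lemma erfc_zero_lim : Tendsto erfc atTop (nhds 0) := by
  have h := aux_zero.const_mul (2 / Real.sqrt Real.pi)
  rw [mul_zero] at h
  exact h

lemma log_erfc : ∃ C : ℝ, Tendsto (fun z => Real.log (erfc (z / Real.sqrt 2)) + z ^ 2 / 2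
    + Real.log z) atTop (nhds C) := by
  have hpi := Real.pi_pos
  have hs : 0 < 2 / Real.sqrt Real.pi := by positivity
  have h2 : 0 < Real.sqrt 2 := by positivity
  have h1 : Tendsto (fun z : ℝ => z / Real.sqrt 2) atTop atTop :=
    tendsto_id.atTop_div_const h2
  have h := ((aux_mills.comp h1).log (by norm_num)).add_const
    (Real.log (2 / Real.sqrt Real.pi) + Real.log (Real.sqrt 2))
  refine ⟨_, h.congr' ?_⟩
  filter_upwards [eventually_gt_atTop 0] with z hz
  have hp := aux_pos_s8 (z / Real.sqrt 2)
  have e : (z / Real.sqrt 2) ^ 2 = z ^ 2 / 2 := by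
    rw [div_pow, Real.sq_sqrt (by norm_num)]
  simp only [Function.comp, erfc]
  rw [Real.log_mul hs.ne' hp.ne', Real.log_div hp.ne' (by positivity),
    Real.log_mul (by positivity) (by positivity), Real.log_exp, Real.log_inv,
    Real.log_div hz.ne' h2.ne', e]
  ring

lemma gap {a b : ℝ → ℝ} {c : ℝ} (ha : Tendsto a atTop atTop) (hb : Tendsto b atTop atTop)
    (h : Tendsto (fun x => (b x ^ 2 - a x ^ 2) / 2 + (Real.log (b x) - Real.log (a x)))
      atTop (nhds c)) :
    Tendsto (fun x => b x - a x) atTop (nhds 0) ∧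
    Tendsto (fun x => (b x ^ 2 - a x ^ 2) / 2) atTop (nhds c) := by
  have hbd : ∀ᶠ x in atTop, |(b x ^ 2 - a x ^ 2) / 2| ≤ |c| + 1 := by
    have h1 := h.abs.eventually (eventually_le_nhds (lt_add_one |c|))
    filter_upwards [h1, ha.eventually_ge_atTop 1, hb.eventually_ge_atTop 1] with x hx h2 h3
    refine le_trans ?_ hx
    rcases le_total (a x) (b x) with h4 | h4
    · have h5 := Real.log_le_log (by linarith) h4
      have h6 : 0 ≤ b x ^ 2 - a x ^ 2 := by nlinarith
      rw [abs_of_nonneg (by linarith), abs_of_nonneg (by linarith)]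
      linarith
    · have h5 := Real.log_le_log (by linarith) h4
      have h6 : b x ^ 2 - a x ^ 2 ≤ 0 := by nlinarith
      rw [abs_of_nonpos (by linarith), abs_of_nonpos (by linarith)]
      linarith
  have hd : Tendsto (fun x => b x - a x) atTop (nhds 0) := by
    refine squeeze_zero_norm' (a := fun x => 2 * (|c| + 1) / a x) ?_ (ha.const_div_atTop _)
    filter_upwards [hbd, ha.eventually_ge_atTop 1, hb.eventually_ge_atTop 1] with x hx h2 h3
    rw [Real.norm_eq_abs, le_div_iff₀ (by linarith)]
    have e : |(b x ^ 2 - a x ^ 2) / 2| = |b x - a x| * (b x + a x) / 2 := by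
      rw [show (b x ^ 2 - a x ^ 2) / 2 = (b x - a x) * ((b x + a x) / 2) by ring, abs_mul,
        abs_of_nonneg (show 0 ≤ (b x + a x) / 2 by linarith)]
      ring
    rw [e] at hx
    nlinarith [abs_nonneg (b x - a x)]
  refine ⟨hd, ?_⟩
  have hr : Tendsto (fun x => Real.log (1 + (b x - a x) / a x)) atTop (nhds 0) := by
    have := ((hd.div_atTop ha).const_add 1).log (by norm_num)
    simpa using this
  have := h.sub hr
  rw [sub_zero] at this
  refine this.congr' ?_
  filter_upwards [ha.eventually_ge_atTop 1, hb.eventually_ge_atTop 1] with x h2 h3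
  rw [← Real.log_div (by linarith) (by linarith)]
  rw [show 1 + (b x - a x) / a x = b x / a x by
    have : a x ≠ 0 := by linarith
    field_simp; ring]
  ring

lemma inv_exists (lam : ℝ) (hlam : 0 < lam) : ∃ a : ℝ → ℝ, Tendsto a atTop atTop ∧
    ∀ᶠ x in atTop, ttf lam (a x) = x := by
  have h2 : 0 < Real.sqrt 2 := by positivity
  have hc : Continuous (ttf lam) := by
    unfold ttf
    refine continuous_const.mul (Continuous.sub ?_ continuous_const)
    exact (erfc_cont.comp (continuous_id.div_const _)).rpow_const
      fun z => Or.inl (erfc_pos' _).ne'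
  have hmono : Monotone (ttf lam) := by
    intro z w hzw
    unfold ttf
    have h1 := erfc_anti.antitone (div_le_div_of_nonneg_right hzw h2.le)
    have h3 := Real.rpow_le_rpow_of_nonpos (erfc_pos' _) h1 (by linarith : -lam ≤ 0)
    have : 0 < 1 / lam := by positivity
    gcongr
  have htop : Tendsto (ttf lam) atTop atTop := by
    unfold ttf
    refine Tendsto.const_mul_atTop (by positivity) (tendsto_atTop_add_const_right _ _ ?_)
    have h1 : Tendsto (fun z : ℝ => erfc (z / Real.sqrt 2)) atTop (nhdsWithin 0 (Set.Ioi 0)) :=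
      tendsto_nhdsWithin_iff.2 ⟨erfc_zero_lim.comp (tendsto_id.atTop_div_const h2),
        Eventually.of_forall fun z => erfc_pos' _⟩
    exact (tendsto_rpow_neg_nhdsGT_zero (by linarith)).comp h1
  have hex : ∀ x : ℝ, ∃ z, ttf lam 0 ≤ x → ttf lam z = x := by
    intro x
    by_cases hx : ttf lam 0 ≤ x
    · obtain ⟨w, hw⟩ := (htop.eventually_ge_atTop x).exists
      have := intermediate_value_uIcc (a := 0) (b := w) hc.continuousOn
      obtain ⟨z, -, hz⟩ := this (Set.mem_uIcc.2 (Or.inl ⟨hx, hw⟩))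
      exact ⟨z, fun _ => hz⟩
    · exact ⟨0, fun h => absurd h hx⟩
  choose a ha using hex
  refine ⟨a, ?_, ?_⟩
  · rw [tendsto_atTop]
    intro M
    filter_upwards [eventually_ge_atTop (ttf lam 0), eventually_gt_atTop (ttf lam M)] with x h1 h3
    by_contra hlt
    have := hmono (not_le.1 hlt).le
    rw [ha x h1] at this
    linarith
  · filter_upwards [eventually_ge_atTop (ttf lam 0)] with x h1 using ha x h1

lemma log_of_ttf {lam z x : ℝ} (hlam : 0 < lam) (h : ttf lam z = x) :
    0 < lam * x + 1 ∧
    Real.log (erfc (z / Real.sqrt 2)) = -(1 / lam) * Real.log (lam * x + 1) := by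
  have hp := erfc_pos' (z / Real.sqrt 2)
  have e : lam * x + 1 = erfc (z / Real.sqrt 2) ^ (-lam) := by
    rw [← h, ttf]; field_simp; ring
  rw [e]
  refine ⟨Real.rpow_pos_of_pos hp _, ?_⟩
  rw [Real.log_rpow hp]; field_simp

lemma normal_exp (m σ a b : ℝ) (hσ : 0 < σ) : normalPDF m σ b / normalPDF m σ a
    = Real.exp (-((b ^ 2 - a ^ 2) / 2) / σ ^ 2 + m / σ ^ 2 * (b - a)) := by
  have hpi := Real.pi_pos
  unfold normalPDF
  rw [mul_div_mul_left _ _ (by positivity), ← Real.exp_sub]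
  congr 1
  field_simp
  ring

lemma ttfDeriv_exp (lam a b : ℝ) : ttfDeriv lam a / ttfDeriv lam b
    = Real.exp ((b ^ 2 - a ^ 2) / 2 + (-lam - 1) *
      (Real.log (erfc (a / Real.sqrt 2)) - Real.log (erfc (b / Real.sqrt 2)))) := by
  have hpi := Real.pi_pos
  unfold ttfDeriv
  rw [Real.rpow_def_of_pos (erfc_pos' _), Real.rpow_def_of_pos (erfc_pos' _), mul_assoc, mul_assoc,
    mul_div_mul_left _ _ (by positivity), ← Real.exp_add, ← Real.exp_add, ← Real.exp_sub]
  congr 1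
  ring

/-- if `p(z) ∼ p_N(z; μ, σ²)` as `z → ∞` and `X = S(Z; λ)` has density `q`
related to `p` by the change-of-variables identity, then `q` is regularly varying of
index `-(1 + 1/(λσ²))`, i.e. `X` lies in the Fréchet domain of attraction with shape
parameter `λσ²`. -/
theorem ttf_frechet_domain
    {Ω : Type*} [MeasurableSpace Ω] (P : Measure Ω) [IsProbabilityMeasure P]
    (lam m σ : ℝ) (hlam : 0 < lam) (hσ : 0 < σ)
    (Z : Ω → ℝ) (hZ : Measurable Z) (p q : ℝ → ℝ)
    (hp : Measure.map Z P = volume.withDensity (fun z => ENNReal.ofReal (p z)))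
    (hptail : Tendsto (fun z => p z / normalPDF m σ z) atTop (nhds 1))
    (hq : ∀ z : ℝ, q (ttf lam z) * ttfDeriv lam z = p z) :
    ∀ k : ℝ, 0 < k →
      Tendsto (fun x => q (k * x) / q x) atTop (nhds (k ^ (-(1 + 1 / (lam * σ ^ 2))))) := by
  intro k hk
  obtain ⟨a, ha, hax⟩ := inv_exists lam hlam
  have hkx : Tendsto (fun x : ℝ => k * x) atTop atTop := tendsto_id.const_mul_atTop hk
  have hb : Tendsto (fun x => a (k * x)) atTop atTop := ha.comp hkx
  have hbx : ∀ᶠ x in atTop, ttf lam (a (k * x)) = k * x := hkx.eventually hax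
  set c : ℝ := Real.log k / lam with hc
  -- log ratio of the tails
  have hE : Tendsto (fun x => Real.log (erfc (a x / Real.sqrt 2))
      - Real.log (erfc (a (k * x) / Real.sqrt 2))) atTop (nhds c) := by
    have h1 : Tendsto (fun x : ℝ => k + (1 - k) / (lam * x + 1)) atTop (nhds (k + 0)) :=
      tendsto_const_nhds.add (Tendsto.const_div_atTop
        (tendsto_atTop_add_const_right _ _ (tendsto_id.const_mul_atTop hlam)) _)
    rw [add_zero] at h1
    have h2 := (h1.log hk.ne').const_mul (1 / lam)
    rw [show 1 / lam * Real.log k = c by rw [hc]; ring] at h2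
    refine h2.congr' ?_
    filter_upwards [hax, hbx] with x h3 h4
    obtain ⟨h5, h6⟩ := log_of_ttf hlam h3
    obtain ⟨h7, h8⟩ := log_of_ttf hlam h4
    rw [h6, h8, show k + (1 - k) / (lam * x + 1) = (lam * (k * x) + 1) / (lam * x + 1) by
      rw [eq_div_iff h5.ne', add_mul, div_mul_cancel₀ _ h5.ne']; ring,
      Real.log_div h7.ne' h5.ne']
    ring
  obtain ⟨C, hC⟩ := log_erfc
  have hG : Tendsto (fun x => (a (k * x) ^ 2 - a x ^ 2) / 2
      + (Real.log (a (k * x)) - Real.log (a x))) atTop (nhds c) := by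
    have := ((hC.comp hb).sub (hC.comp ha)).add hE
    rw [sub_self, zero_add] at this
    refine this.congr fun x => ?_
    simp only [Function.comp]
    ring
  obtain ⟨hd, hD⟩ := gap ha hb hG
  have hN := ((hD.neg.div_const (σ ^ 2)).add (hd.const_mul (m / σ ^ 2))).rexp
  have hS := (hD.add (hE.const_mul (-lam - 1))).rexp
  have hP := (hptail.comp hb).div (hptail.comp ha) one_ne_zero
  have hall := (hP.mul hN).mul hS
  have hlim : 1 / 1 * Real.exp (-c / σ ^ 2 + m / σ ^ 2 * 0) * Real.exp (c + (-lam - 1) * c)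
      = k ^ (-(1 + 1 / (lam * σ ^ 2))) := by
    rw [Real.rpow_def_of_pos hk, div_one, one_mul, ← Real.exp_add, hc]
    congr 1
    field_simp
    ring
  rw [hlim] at hall
  refine hall.congr' ?_
  have hdpos : ∀ z, 0 < ttfDeriv lam z := fun z => by
    have := Real.rpow_pos_of_pos (erfc_pos' (z / Real.sqrt 2)) (-lam - 1)
    have := Real.pi_pos
    unfold ttfDeriv; positivity
  have hnpos : ∀ z, 0 < normalPDF m σ z := fun z => by
    have := Real.pi_pos
    unfold normalPDF; positivity
  filter_upwards [hax, hbx] with x h3 h4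
  have e1 : q x = p (a x) / ttfDeriv lam (a x) := by
    rw [eq_div_iff (hdpos _).ne', ← hq, h3]
  have e2 : q (k * x) = p (a (k * x)) / ttfDeriv lam (a (k * x)) := by
    rw [eq_div_iff (hdpos _).ne', ← hq, h4]
  rw [e1, e2, ← normal_exp m σ _ _ hσ, ← ttfDeriv_exp]
  simp only [Pi.div_apply, Function.comp]
  have := (hdpos (a x)).ne'
  have := (hdpos (a (k * x))).ne'
  have := (hnpos (a x)).ne'
  have := (hnpos (a (k * x))).ne'
  by_cases h0 : p (a x) = 0
  · simp [h0]
  field_simp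
end

section
/- Fix λ > 0. Then z − ((2/λ)·log(λ·S(z; λ) + 1))^(1/2) → 0 as z → +∞; that is, if x = S(z; λ) then z = ((2/λ)·log(λx + 1))^(1/2) + o(1) as x → ∞. -/
open MeasureTheory Real Filter

lemma gauss_int (w : ℝ) : IntegrableOn (fun t : ℝ => Real.exp (-t ^ 2)) (Set.Ioi w) := by
  have h := (integrable_exp_neg_mul_sq (b := 1) one_pos).integrableOn (s := Set.Ioi w)
  simpa using h

lemma gauss_upper (w : ℝ) (hw : 1 ≤ w) :
    ∫ t in Set.Ioi w, Real.exp (-t ^ 2) ≤ Real.exp (-w ^ 2) := by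
  have h0 : -w < 0 := by linarith
  have hi := integrableOn_exp_mul_Ioi h0 w
  have h1 : ∫ t in Set.Ioi w, Real.exp (-t ^ 2) ≤ ∫ t in Set.Ioi w, Real.exp (-w * t) := by
    apply setIntegral_mono_on (gauss_int w) hi measurableSet_Ioi
    intro t ht
    have ht' : w < t := ht
    apply Real.exp_le_exp.2
    nlinarith
  rw [integral_exp_mul_Ioi h0 w] at h1
  refine h1.trans ?_
  rw [neg_div_neg_eq, show -w * w = -w ^ 2 by ring]
  exact div_le_self (Real.exp_pos _).le hw

lemma gauss_lower (w : ℝ) (hw : 1 ≤ w) :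
    Real.exp (-w ^ 2 - 3) / w ≤ ∫ t in Set.Ioi w, Real.exp (-t ^ 2) := by
  have hw0 : 0 < w := by linarith
  have hsub : Set.Ioc w (w + 1 / w) ⊆ Set.Ioi w := Set.Ioc_subset_Ioi_self
  have h1 : ∫ t in Set.Ioc w (w + 1 / w), Real.exp (-t ^ 2)
      ≤ ∫ t in Set.Ioi w, Real.exp (-t ^ 2) :=
    setIntegral_mono_set (gauss_int w) (Eventually.of_forall fun t => (Real.exp_pos _).le)
      hsub.eventuallyLE
  refine le_trans ?_ h1
  have h2 : ∫ t in Set.Ioc w (w + 1 / w), Real.exp (-w ^ 2 - 3)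
      ≤ ∫ t in Set.Ioc w (w + 1 / w), Real.exp (-t ^ 2) := by
    apply setIntegral_mono_on _ ((gauss_int w).mono_set hsub) measurableSet_Ioc
    · intro t ht
      apply Real.exp_le_exp.2
      have a1 : t ^ 2 ≤ (w + 1 / w) ^ 2 := pow_le_pow_left₀ (by linarith [ht.1]) ht.2 2
      have a2 : (w + 1 / w) ^ 2 = w ^ 2 + 2 + (1 / w) ^ 2 := by field_simp; ring
      have a3 : (1 / w) ^ 2 ≤ 1 := pow_le_one₀ (by positivity) (by rw [div_le_one hw0]; exact hw)
      linarith
    · exact integrableOn_const (by simp)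
  refine le_trans (le_of_eq ?_) h2
  have : 0 ≤ w⁻¹ := by positivity
  simp [this, div_eq_mul_inv, mul_comm]

lemma log_erfc_bounds (w : ℝ) (hw : 1 ≤ w) :
    0 < erfc w ∧ -w ^ 2 - 3 - Real.log w ≤ Real.log (erfc w) ∧
      Real.log (erfc w) ≤ -w ^ 2 + 1 := by
  have hw0 : 0 < w := by linarith
  have hs0 : 0 < Real.sqrt Real.pi := Real.sqrt_pos.2 Real.pi_pos
  have hs1 : 1 ≤ Real.sqrt Real.pi := Real.one_le_sqrt.2 (by linarith [Real.pi_gt_three])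
  have hs2 : Real.sqrt Real.pi ≤ 2 := by
    rw [Real.sqrt_le_left (by norm_num)]; linarith [Real.pi_le_four]
  have c1 : 1 ≤ 2 / Real.sqrt Real.pi := by rw [le_div_iff₀ hs0]; linarith
  have c2 : 2 / Real.sqrt Real.pi ≤ 2 := div_le_self (by norm_num) hs1
  have hl := gauss_lower w hw
  have hu := gauss_upper w hw
  have hp : 0 < Real.exp (-w ^ 2 - 3) / w := by positivity
  have l : Real.exp (-w ^ 2 - 3) / w ≤ erfc w := by unfold erfc; nlinarith
  have hpos : 0 < erfc w := lt_of_lt_of_le hp l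
  refine ⟨hpos, ?_, ?_⟩
  · have := Real.log_le_log hp l
    rwa [Real.log_div (Real.exp_pos _).ne' hw0.ne', Real.log_exp] at this
  · rw [Real.log_le_iff_le_exp hpos, Real.exp_add]
    have e : 2 ≤ Real.exp 1 := by linarith [Real.add_one_le_exp (1 : ℝ)]
    have := Real.exp_pos (-w ^ 2)
    have : erfc w ≤ 2 * Real.exp (-w ^ 2) := by
      unfold erfc
      exact mul_le_mul c2 hu (hp.le.trans hl) (by norm_num)
    nlinarith

/-- for fixed `λ > 0`,
`z - ((2/λ) log(λ S(z; λ) + 1))^(1/2) → 0` as `z → ∞`. -/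
theorem ttf_expansion_first_order (lam : ℝ) (hlam : 0 < lam) :
    Tendsto (fun z => z - Real.sqrt ((2 / lam) * Real.log (lam * ttf lam z + 1)))
      atTop (nhds 0) := by
  have hlim : Tendsto (fun z : ℝ => 6 * z⁻¹ + 2 * (Real.log z / z)) atTop (nhds 0) := by
    have h1 := (tendsto_inv_atTop_zero (𝕜 := ℝ)).const_mul 6
    have h2 : Tendsto (fun z : ℝ => Real.log z / z) atTop (nhds 0) :=
      Real.isLittleO_log_id_atTop.tendsto_div_nhds_zero
    simpa using h1.add (h2.const_mul 2)
  apply squeeze_zero_norm' _ hlim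
  filter_upwards [eventually_ge_atTop (2 : ℝ)] with z hz
  have hz0 : 0 < z := by linarith
  have q0 : 0 < Real.sqrt 2 := by positivity
  have q1 : 1 ≤ Real.sqrt 2 := Real.one_le_sqrt.2 (by norm_num)
  have q2 : Real.sqrt 2 ≤ 2 := by rw [Real.sqrt_le_left (by norm_num)]; norm_num
  have hw : 1 ≤ z / Real.sqrt 2 := by rw [le_div_iff₀ q0]; linarith
  have hwz : z / Real.sqrt 2 ≤ z := div_le_self hz0.le q1
  have hw2 : (z / Real.sqrt 2) ^ 2 = z ^ 2 / 2 := by rw [div_pow, Real.sq_sqrt (by norm_num)]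
  obtain ⟨hp, hl, hu⟩ := log_erfc_bounds _ hw
  have hlog := Real.log_le_log (by linarith) hwz
  have hlogz : 0 ≤ Real.log z := Real.log_nonneg (by linarith)
  have hQ : (2 / lam) * Real.log (lam * ttf lam z + 1)
      = -2 * Real.log (erfc (z / Real.sqrt 2)) := by
    have : lam * ttf lam z + 1 = (erfc (z / Real.sqrt 2)) ^ (-lam) := by
      unfold ttf; field_simp; ring
    rw [this, Real.log_rpow hp]; field_simp
  rw [hQ]
  rw [hw2] at hl hu
  generalize Real.log (erfc (z / Real.sqrt 2)) = L at *
  have hQ0 : 0 ≤ -2 * L := by nlinarith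
  have hsq := Real.sq_sqrt hQ0
  have hsn := Real.sqrt_nonneg (-2 * L)
  generalize Real.sqrt (-2 * L) = s at *
  have hb : 6 * z⁻¹ + 2 * (Real.log z / z) = (6 + 2 * Real.log z) / z := by ring
  rw [hb, le_div_iff₀ hz0, Real.norm_eq_abs]
  have h1 : |z - s| * z ≤ |z - s| * (z + s) :=
    mul_le_mul_of_nonneg_left (by linarith) (abs_nonneg _)
  have h2 : |z - s| * (z + s) = |z ^ 2 - s ^ 2| := by
    rw [show z ^ 2 - s ^ 2 = (z - s) * (z + s) by ring, abs_mul,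
      abs_of_nonneg (show 0 ≤ z + s by linarith)]
  rw [h2] at h1
  refine h1.trans (abs_le.2 ⟨?_, ?_⟩) <;> linarith
end

section
/- Fix λ > 0 and for z > 0 set η(z) = (2/λ)·log(λ·S(z; λ) + 1) + log(2/π). Then z² − (η(z) − log η(z)) → 0 as z → +∞. -/
open MeasureTheory Real Filter

/-- `η(z) = (2/λ) log(λ S(z;λ) + 1) + log(2/π)`. -/
noncomputable def ttfEta (lam z : ℝ) : ℝ :=
  (2 / lam) * Real.log (lam * ttf lam z + 1) + Real.log (2 / Real.pi)

lemma hd1 (t : ℝ) : HasDerivAt (fun t : ℝ => -(Real.exp (-t ^ 2) / 2)) (t * Real.exp (-t ^ 2)) t := by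
  have h : HasDerivAt (fun t : ℝ => Real.exp (-t ^ 2)) (Real.exp (-t ^ 2) * (-(2 * t))) t := by
    have := ((hasDerivAt_pow 2 t).fun_neg).exp
    simpa using this
  refine (h.div_const 2).fun_neg.congr_deriv ?_
  ring

lemma hd2 (t : ℝ) (ht : 0 < t) : HasDerivAt (fun t : ℝ => -(Real.exp (-t ^ 2) / (2 * t)))
    ((1 + 1 / (2 * t ^ 2)) * Real.exp (-t ^ 2)) t := by
  have h : HasDerivAt (fun t : ℝ => Real.exp (-t ^ 2)) (Real.exp (-t ^ 2) * (-(2 * t))) t := by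
    have := ((hasDerivAt_pow 2 t).fun_neg).exp
    simpa using this
  have h2 : HasDerivAt (fun t : ℝ => 2 * t) 2 t := by
    simpa using (hasDerivAt_id t).const_mul 2
  refine (h.fun_div h2 (by positivity)).fun_neg.congr_deriv ?_
  field_simp
  ring

lemma tend_exp : Tendsto (fun t : ℝ => Real.exp (-t ^ 2)) atTop (nhds 0) := by
  apply Real.tendsto_exp_atBot.comp
  exact tendsto_neg_atTop_atBot.comp (tendsto_pow_atTop (by norm_num))

lemma int_exp (x : ℝ) : IntegrableOn (fun t : ℝ => Real.exp (-t ^ 2)) (Set.Ioi x) := by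
  have := (integrable_exp_neg_mul_sq (b := 1) one_pos).integrableOn (s := Set.Ioi x)
  simpa using this

lemma upper (x : ℝ) (hx : 0 < x) :
    2 * x * ∫ t in Set.Ioi x, Real.exp (-t ^ 2) ≤ Real.exp (-x ^ 2) := by
  have ht : Tendsto (fun t : ℝ => -(Real.exp (-t ^ 2) / 2)) atTop (nhds 0) := by
    simpa using (tend_exp.div_const 2).neg
  have hpos : ∀ t ∈ Set.Ioi x, 0 ≤ t * Real.exp (-t ^ 2) := fun t h => by
    have : 0 < t := hx.trans h
    positivity
  have hi := integrableOn_Ioi_deriv_of_nonneg' (fun t _ => hd1 t) hpos ht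
  have he := integral_Ioi_of_hasDerivAt_of_nonneg' (fun t _ => hd1 t) hpos ht
  have hle : ∫ t in Set.Ioi x, x * Real.exp (-t ^ 2) ≤ ∫ t in Set.Ioi x, t * Real.exp (-t ^ 2) := by
    apply setIntegral_mono_on ((int_exp x).const_mul x) hi measurableSet_Ioi
    intro t h
    have : x ≤ t := le_of_lt h
    gcongr
  rw [he, integral_const_mul] at hle
  linarith

lemma lower (x : ℝ) (hx : 0 < x) :
    Real.exp (-x ^ 2) ≤ (1 + 1 / (2 * x ^ 2)) * (2 * x * ∫ t in Set.Ioi x, Real.exp (-t ^ 2)) := by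
  have ht : Tendsto (fun t : ℝ => -(Real.exp (-t ^ 2) / (2 * t))) atTop (nhds 0) := by
    have := (tend_exp.mul ((tendsto_inv_atTop_zero (𝕜 := ℝ)).comp
      (tendsto_id.const_mul_atTop (two_pos)))).neg
    simpa [div_eq_mul_inv] using this
  have hpos : ∀ t ∈ Set.Ioi x, 0 ≤ (1 + 1 / (2 * t ^ 2)) * Real.exp (-t ^ 2) := fun t h => by
    positivity
  have hi := integrableOn_Ioi_deriv_of_nonneg' (fun t h => hd2 t (hx.trans_le h)) hpos ht
  have he := integral_Ioi_of_hasDerivAt_of_nonneg' (fun t h => hd2 t (hx.trans_le h)) hpos ht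
  have hle : ∫ t in Set.Ioi x, (1 + 1 / (2 * t ^ 2)) * Real.exp (-t ^ 2) ≤
      ∫ t in Set.Ioi x, (1 + 1 / (2 * x ^ 2)) * Real.exp (-t ^ 2) := by
    apply setIntegral_mono_on hi ((int_exp x).const_mul _) measurableSet_Ioi
    intro t h
    have : x ≤ t := le_of_lt h
    gcongr
  rw [he, integral_const_mul] at hle
  have h3 : Real.exp (-x ^ 2) = 2 * x * (0 - -(Real.exp (-x ^ 2) / (2 * x))) := by
    field_simp
    ring
  rw [h3]
  calc _ ≤ 2 * x * _ := mul_le_mul_of_nonneg_left hle (by positivity)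
    _ = _ := by ring

/-- The normalised Gaussian tail. -/
noncomputable def tailRatio (x : ℝ) : ℝ :=
  2 * x * (∫ t in Set.Ioi x, Real.exp (-t ^ 2)) * Real.exp (x ^ 2)

lemma ratio_le (x : ℝ) (hx : 0 < x) : tailRatio x ≤ 1 := by
  have := mul_le_mul_of_nonneg_right (upper x hx) (Real.exp_pos (x ^ 2)).le
  rwa [← Real.exp_add, neg_add_cancel, Real.exp_zero] at this

lemma ratio_ge (x : ℝ) (hx : 0 < x) : (1 + 1 / (2 * x ^ 2))⁻¹ ≤ tailRatio x := by
  have := mul_le_mul_of_nonneg_right (lower x hx) (Real.exp_pos (x ^ 2)).le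
  rw [← Real.exp_add, neg_add_cancel, Real.exp_zero, mul_assoc] at this
  rw [inv_le_iff_one_le_mul₀' (by positivity)]
  exact this

lemma ratio_tendsto : Tendsto tailRatio atTop (nhds 1) := by
  have h : Tendsto (fun x : ℝ => (1 + 1 / (2 * x ^ 2))⁻¹) atTop (nhds 1) := by
    have h1 : Tendsto (fun x : ℝ => 2 * x ^ 2) atTop atTop :=
      (tendsto_pow_atTop (by norm_num)).const_mul_atTop two_pos
    have h2 := ((tendsto_inv_atTop_zero.comp h1).const_add 1).inv₀ (by norm_num)
    simpa using h2
  refine tendsto_of_tendsto_of_tendsto_of_le_of_le' h tendsto_const_nhds ?_ ?_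
  · filter_upwards [eventually_gt_atTop 0] with x hx using ratio_ge x hx
  · filter_upwards [eventually_gt_atTop 0] with x hx using ratio_le x hx

lemma eta_eq (lam : ℝ) (hlam : 0 < lam) (z : ℝ) (hz : 0 < z) :
    ttfEta lam z = z ^ 2 + 2 * Real.log z - 2 * Real.log (tailRatio (z / √2)) := by
  have hx : 0 < z / √2 := by positivity
  have hr : 0 < tailRatio (z / √2) := lt_of_lt_of_le (by positivity) (ratio_ge _ hx)
  have hE : erfc (z / √2) =
      (2 / √π) * (tailRatio (z / √2) / (2 * (z / √2) * Real.exp ((z / √2) ^ 2))) := by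
    unfold erfc tailRatio
    field_simp
  have hEpos : 0 < erfc (z / √2) := by rw [hE]; positivity
  have h1 : lam * ttf lam z + 1 = erfc (z / √2) ^ (-lam) := by
    unfold ttf
    field_simp
    ring
  unfold ttfEta
  rw [h1, Real.log_rpow hEpos, hE, Real.log_mul (by positivity) (by positivity),
    Real.log_div (by positivity) (by positivity), Real.log_div (by positivity) (by positivity),
    Real.log_mul (by positivity) (by positivity), Real.log_mul (by positivity) (by positivity),
    Real.log_div (by positivity) (by positivity), Real.log_div (by positivity) (by positivity),
    Real.log_exp, Real.log_sqrt (by positivity), Real.log_sqrt (by positivity), div_pow,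
    Real.sq_sqrt (by norm_num)]
  field_simp
  ring

/-- for fixed `λ > 0`, `z² - (η(z) - log η(z)) → 0` as `z → ∞`. -/
theorem ttf_eta_expansion (lam : ℝ) (hlam : 0 < lam) :
    Tendsto (fun z => z ^ 2 - (ttfEta lam z - Real.log (ttfEta lam z)))
      atTop (nhds 0) := by
  have hR : Tendsto (fun z : ℝ => Real.log (tailRatio (z / √2))) atTop (nhds 0) := by
    have h0 : Tendsto (fun z : ℝ => z / √2) atTop atTop :=
      tendsto_id.atTop_div_const (by positivity)
    have := (ratio_tendsto.comp h0).log one_ne_zero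
    simpa using this
  have hinv : Tendsto (fun z : ℝ => (z ^ 2)⁻¹) atTop (nhds 0) :=
    tendsto_inv_atTop_zero.comp (tendsto_pow_atTop (by norm_num))
  have hlog : Tendsto (fun z : ℝ => Real.log z / z ^ 2) atTop (nhds 0) := by
    have := (isLittleO_log_rpow_atTop (r := 2) two_pos).tendsto_div_nhds_zero
    simpa using this
  have hQ : Tendsto (fun z : ℝ => 1 + 2 * (Real.log z / z ^ 2)
      - 2 * (Real.log (tailRatio (z / √2)) * (z ^ 2)⁻¹)) atTop (nhds 1) := by
    have := ((hlog.const_mul 2).const_add 1).sub ((hR.mul hinv).const_mul 2)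
    simpa using this
  have hF := (hR.const_mul 2).add (hQ.log one_ne_zero)
  simp only [mul_zero, Real.log_one, add_zero] at hF
  refine hF.congr' ?_
  filter_upwards [eventually_gt_atTop 0, Tendsto.eventually_const_lt (u := (0 : ℝ)) one_pos hQ] with z hz hq
  have he : ttfEta lam z = z ^ 2 * (1 + 2 * (Real.log z / z ^ 2)
      - 2 * (Real.log (tailRatio (z / √2)) * (z ^ 2)⁻¹)) := by
    rw [eta_eq lam hlam z hz]
    field_simp
  have hl : Real.log (ttfEta lam z) = 2 * Real.log z + Real.log (1 + 2 * (Real.log z / z ^ 2)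
      - 2 * (Real.log (tailRatio (z / √2)) * (z ^ 2)⁻¹)) := by
    rw [he, Real.log_mul (by positivity) hq.ne', Real.log_pow]
    norm_num
  rw [hl, eta_eq lam hlam z hz]
  ring
end

section
/- Let ℓ : (0,∞) → (0,∞) be a Lebesgue measurable slowly varying function and let ρ ∈ ℝ. If ρ < 0 then x^ρ·ℓ(x) → 0 as x → ∞, and if ρ > 0 then x^ρ·ℓ(x) → ∞ as x → ∞. -/
open Real Filter

/-- Integrated truncated oscillation tends to zero. -/
lemma osc_tendsto (h : ℝ → ℝ) (hm : Measurable h)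
    (hs : ∀ u : ℝ, Tendsto (fun t => h (t + u) - h t) atTop (nhds 0)) :
    Tendsto (fun t => ∫ s in (0:ℝ)..2, min 1 |h (t + s) - h t|) atTop (nhds 0) := by
  have key := intervalIntegral.tendsto_integral_filter_of_dominated_convergence
    (μ := MeasureTheory.volume) (a := 0) (b := 2) (l := (atTop : Filter ℝ))
    (F := fun t s => min 1 |h (t + s) - h t|) (f := fun _ => (0:ℝ)) (fun _ => (1:ℝ))
    (Eventually.of_forall fun t => by
      apply Measurable.aestronglyMeasurable
      fun_prop)
    (Eventually.of_forall fun t => Eventually.of_forall fun s _ => by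
      rw [Real.norm_eq_abs, abs_of_nonneg (by positivity)]
      exact min_le_left _ _)
    (by simp)
    (Eventually.of_forall fun s _ => by
      have h1 := (hs s).abs
      have h2 := (tendsto_const_nhds (x := (1:ℝ))).min h1
      simpa using h2)
  simpa using key

lemma osc_int (h : ℝ → ℝ) (hm : Measurable h) (t a b c : ℝ) :
    IntervalIntegrable (fun s => min 1 |h (t + s) - c|) MeasureTheory.volume a b := by
  apply (intervalIntegrable_const (c := (1:ℝ))).mono_fun
  · apply Measurable.aestronglyMeasurable
    fun_prop
  · refine Eventually.of_forall fun s => ?_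
    simp only [Real.norm_eq_abs]
    rw [abs_of_nonneg (by positivity)]
    simp

lemma osc_bdd (h : ℝ → ℝ) (hm : Measurable h)
    (hs : ∀ u : ℝ, Tendsto (fun t => h (t + u) - h t) atTop (nhds 0)) :
    ∃ T : ℝ, ∀ t ≥ T, ∀ u : ℝ, 0 ≤ u → u ≤ 1 → |h (t + u) - h t| ≤ 1 := by
  have hI := (osc_tendsto h hm hs).eventually (gt_mem_nhds (show (0:ℝ) < 1/2 by norm_num))
  obtain ⟨T, hT⟩ := eventually_atTop.1 hI
  refine ⟨T, fun t ht u hu0 hu1 => ?_⟩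
  by_contra! hc
  have h1 := hT t ht
  have h2 := hT (t + u) (by linarith)
  have h3 : ∫ s in (1:ℝ)..2, min 1 |h (t + s) - h t| ≤
      ∫ s in (0:ℝ)..2, min 1 |h (t + s) - h t| := by
    apply intervalIntegral.integral_mono_interval (by norm_num) (by norm_num) le_rfl
    · exact Eventually.of_forall fun s => by simp
    · exact osc_int h hm _ _ _ _
  have h4 : ∫ s in (1 - u)..(2 - u), min 1 |h (t + u + s) - h (t + u)| ≤
      ∫ s in (0:ℝ)..2, min 1 |h (t + u + s) - h (t + u)| := by
    apply intervalIntegral.integral_mono_interval (by linarith) (by linarith) (by linarith)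
    · exact Eventually.of_forall fun s => by simp
    · exact osc_int h hm _ _ _ _
  rw [← intervalIntegral.integral_comp_sub_right
    (fun s => min 1 |h (t + u + s) - h (t + u)|) u] at h4
  have e : ∀ s, t + u + (s - u) = t + s := fun s => by ring
  simp only [e] at h4
  have h5 : ∫ s in (1:ℝ)..2, (1:ℝ) ≤ ∫ s in (1:ℝ)..2,
      (min 1 |h (t + s) - h t| + min 1 |h (t + s) - h (t + u)|) := by
    apply intervalIntegral.integral_mono_on (by norm_num) (by simp)
      ((osc_int h hm _ _ _ _).add (osc_int h hm _ _ _ _))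
    intro s _
    have a1 := abs_nonneg (h (t + s) - h t)
    have a2 := abs_nonneg (h (t + s) - h (t + u))
    have a3 : |h (t + u) - h t| ≤ |h (t + s) - h t| + |h (t + s) - h (t + u)| := by
      rw [abs_sub_comm (h (t + s)) (h (t + u))]
      have := abs_sub_le (h (t + u)) (h (t + s)) (h t)
      linarith
    rcases min_cases 1 |h (t + s) - h t| with q | q <;>
    rcases min_cases 1 |h (t + s) - h (t + u)| with r | r <;> linarith
  rw [intervalIntegral.integral_add (osc_int h hm _ _ _ _) (osc_int h hm _ _ _ _)] at h5
  norm_num at h5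
  linarith

lemma growth (h : ℝ → ℝ) (hm : Measurable h)
    (hs : ∀ u : ℝ, Tendsto (fun t => h (t + u) - h t) atTop (nhds 0)) (ε : ℝ) (hε : 0 < ε) :
    ∃ C : ℝ, ∀ᶠ t in atTop, |h t| ≤ C + ε * t := by
  obtain ⟨T₁, hT₁⟩ := osc_bdd h hm hs
  have h0 := (hs 1).abs
  rw [abs_zero] at h0
  obtain ⟨T₂, hT₂⟩ := eventually_atTop.1 (h0.eventually (gt_mem_nhds hε))
  set T := max 0 (max T₁ T₂) with hT
  have b0 : 0 ≤ T := le_max_left _ _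
  have b1 : T₁ ≤ T := (le_max_left _ _).trans (le_max_right _ _)
  have b2 : T₂ ≤ T := (le_max_right _ _).trans (le_max_right _ _)
  have ind : ∀ n : ℕ, ∀ t, T ≤ t → t ≤ T + n + 1 → |h t| ≤ |h T| + 1 + ε * n := by
    intro n
    induction n with
    | zero =>
      intro t h1 h2
      have := hT₁ T b1 (t - T) (by linarith) (by simp at h2; linarith)
      rw [add_sub_cancel] at this
      have h3 := abs_sub_abs_le_abs_sub (h t) (h T)
      simp
      linarith
    | succ n ih =>
      intro t h1 h2
      push_cast at h2 ⊢
      by_cases hc : t ≤ T + n + 1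
      · have := ih t h1 hc
        linarith
      · push Not at hc
        have hn : (0:ℝ) ≤ n := n.cast_nonneg
        have h3 := ih (t - 1) (by linarith) (by linarith)
        have h4 := hT₂ (t - 1) (by linarith)
        rw [sub_add_cancel] at h4
        have h5 := abs_sub_abs_le_abs_sub (h t) (h (t - 1))
        linarith
  refine ⟨|h T| + 1, eventually_atTop.2 ⟨T, fun t ht => ?_⟩⟩
  have h1 := ind ⌊t - T⌋₊ t ht (by have := Nat.lt_floor_add_one (t - T); linarith)
  have h2 : (⌊t - T⌋₊ : ℝ) ≤ t := (Nat.floor_le (by linarith)).trans (by linarith)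
  have h3 := mul_le_mul_of_nonneg_left h2 hε.le
  linarith

/-- if `ℓ : (0,∞) → (0,∞)` is a measurable slowly varying function and
`ρ ∈ ℝ`, then `x^ρ ℓ(x) → 0` as `x → ∞` when `ρ < 0`, and `x^ρ ℓ(x) → ∞` as `x → ∞`
when `ρ > 0`. -/
theorem slowly_varying_mul_rpow (ℓ : ℝ → ℝ) (hmeas : Measurable ℓ)
    (hpos : ∀ x : ℝ, 0 < x → 0 < ℓ x)
    (hslow : ∀ k : ℝ, 0 < k →
      Tendsto (fun x => ℓ (k * x) / ℓ x) atTop (nhds 1))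
    (ρ : ℝ) :
    (ρ < 0 → Tendsto (fun x => x ^ ρ * ℓ x) atTop (nhds 0)) ∧
    (0 < ρ → Tendsto (fun x => x ^ ρ * ℓ x) atTop atTop) := by
  set h : ℝ → ℝ := fun t => Real.log (ℓ (Real.exp t)) with hh
  have hm : Measurable h := by fun_prop
  have hs : ∀ u : ℝ, Tendsto (fun t => h (t + u) - h t) atTop (nhds 0) := by
    intro u
    have h1 := ((hslow (Real.exp u) (Real.exp_pos u)).comp Real.tendsto_exp_atTop).log one_ne_zero
    rw [Real.log_one] at h1
    refine h1.congr fun t => ?_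
    simp only [Function.comp, hh]
    rw [← Real.exp_add, add_comm u t,
      Real.log_div (hpos _ (Real.exp_pos _)).ne' (hpos _ (Real.exp_pos _)).ne']
  have heq : ∀ᶠ x : ℝ in atTop,
      Real.exp (ρ * Real.log x + h (Real.log x)) = x ^ ρ * ℓ x := by
    filter_upwards [eventually_gt_atTop 0] with x hx
    simp only [hh]
    rw [Real.exp_add, Real.exp_log hx, Real.exp_log (hpos x hx), Real.rpow_def_of_pos hx, mul_comm ρ]
  constructor
  · intro hρ
    obtain ⟨C, hC⟩ := growth h hm hs (-ρ / 2) (by linarith)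
    have h1 : Tendsto (fun t => ρ * t + h t) atTop atBot := by
      have h2 : Tendsto (fun t => C + (ρ / 2) * t) atTop atBot :=
        tendsto_atBot_add_const_left _ _ (tendsto_id.const_mul_atTop_of_neg (by linarith))
      refine tendsto_atBot_mono' _ ?_ h2
      filter_upwards [hC] with t ht
      have := le_abs_self (h t)
      linarith
    exact (Real.tendsto_exp_atBot.comp (h1.comp Real.tendsto_log_atTop)).congr' heq
  · intro hρ
    obtain ⟨C, hC⟩ := growth h hm hs (ρ / 2) (by linarith)
    have h1 : Tendsto (fun t => ρ * t + h t) atTop atTop := by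
      have h2 : Tendsto (fun t => -C + (ρ / 2) * t) atTop atTop :=
        tendsto_atTop_add_const_left _ _ (tendsto_id.const_mul_atTop (by linarith))
      refine tendsto_atTop_mono' _ ?_ h2
      filter_upwards [hC] with t ht
      have := neg_abs_le (h t)
      linarith
    exact (Real.tendsto_exp_atTop.comp (h1.comp Real.tendsto_log_atTop)).congr' heq
end
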